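/- Let d, N ≥ 1, let L be a positive odd integer, and let δ ∈ (0, 1/2]. Let Λ̃_L = { j ∈ ℤ^d : ‖j‖∞ ≤ (L−1)/2 }. Suppose that for each j ∈ Λ̃_L a point y_j ∈ ℝ^d is given such that the open sup-norm ball B(y_j, δ) is contained in the half-open unit cube C_j. Let u : ℝ^d → ℝ be nonnegative and satisfy u(z) ≥ 1 for every z ∈ B(0, δ). Then for every (x_1, …, x_N) ∈ (ℝ^d)^N, Σ_{i=1}^N Σ_{j ∈ Λ̃_L} u(x_i − y_j) ≥ N · Σ_{(j_1, …, j_N) ∈ Λ̃_L^N} Π_{i=1}^N 1_{B(y_{j_i}, δ)}(x_i), where the sum on the right runs over all N-tuples of points of Λ̃_L and 1_A denotes the indicator function of A. -/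

import Mathlib

/-- The deterministic `N`-body Anderson potential dominates `N`
times the sum over `N`-tuples of lattice points of the product of the
indicators of the sup-norm `δ`-balls. -/
theorem nbody_potential_ge_sum_product_indicators
    (d N L : ℕ) (hd : 1 ≤ d) (hN : 1 ≤ N) (hL : 1 ≤ L) (hLodd : Odd L)
    (δ : ℝ) (hδ0 : 0 < δ) (hδ : δ ≤ 1 / 2)
    (S : Finset (Fin d → ℤ))
    (hS : ∀ j : Fin d → ℤ, j ∈ S ↔ ‖((fun i => (j i : ℝ)) : Fin d → ℝ)‖ ≤ ((L : ℝ) - 1) / 2)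
    (y : (Fin d → ℤ) → (Fin d → ℝ))
    (hy : ∀ j ∈ S, Metric.ball (y j) δ ⊆
      {x : Fin d → ℝ | ∀ i, (j i : ℝ) - 1 / 2 ≤ x i ∧ x i < (j i : ℝ) + 1 / 2})
    (u : (Fin d → ℝ) → ℝ)
    (hu0 : ∀ z, 0 ≤ u z)
    (hu1 : ∀ z ∈ Metric.ball (0 : Fin d → ℝ) δ, 1 ≤ u z)
    (x : Fin N → (Fin d → ℝ)) :
    (N : ℝ) * ∑ J ∈ Fintype.piFinset (fun _ : Fin N => S),
        ∏ i, (Metric.ball (y (J i)) δ).indicator (fun _ => (1 : ℝ)) (x i)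
      ≤ ∑ i, ∑ j ∈ S, u (x i - y j) := by
  classical
  set g : Fin N → (Fin d → ℤ) → ℝ := fun i j =>
    (Metric.ball (y j) δ).indicator (fun _ => (1 : ℝ)) (x i) with hg
  have hg0 : ∀ i j, 0 ≤ g i j := fun i j =>
    Set.indicator_nonneg (fun _ _ => zero_le_one) _
  have hg1 : ∀ i j, g i j ≤ 1 := fun i j =>
    Set.indicator_le_self' (fun _ _ => zero_le_one) _
  have hf0 : ∀ i, 0 ≤ ∑ j ∈ S, g i j := fun i => Finset.sum_nonneg fun j _ => hg0 i j
  have hf1 : ∀ i, ∑ j ∈ S, g i j ≤ 1 := by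
    intro i
    by_cases h : ∃ j ∈ S, x i ∈ Metric.ball (y j) δ
    · obtain ⟨j, hj, hx⟩ := h
      rw [Finset.sum_eq_single_of_mem j hj]
      · exact hg1 i j
      · intro k hk hkj
        apply Set.indicator_of_notMem
        intro hx'
        apply hkj
        funext a
        have h1 := hy j hj hx a
        have h2 := hy k hk hx' a
        have h3 : (k a : ℝ) < j a + 1 := by linarith [h1.1, h1.2, h2.1, h2.2]
        have h4 : (j a : ℝ) < k a + 1 := by linarith [h1.1, h1.2, h2.1, h2.2]
        have h5 : k a < j a + 1 := by exact_mod_cast h3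
        have h6 : j a < k a + 1 := by exact_mod_cast h4
        omega
    · push Not at h
      rw [Finset.sum_eq_zero]
      · exact zero_le_one
      · intro j hj
        exact Set.indicator_of_notMem (h j hj) _
  have hgu : ∀ i j, g i j ≤ u (x i - y j) := by
    intro i j
    apply Set.indicator_apply_le'
    · intro h
      apply hu1
      simpa [dist_eq_norm] using h
    · intro _
      exact hu0 _
  have hprod : ∑ J ∈ Fintype.piFinset (fun _ : Fin N => S), ∏ i, g i (J i)
      = ∏ i, ∑ j ∈ S, g i j := (Finset.prod_univ_sum (fun _ => S) g).symm
  have hle : ∀ i, ∏ k, ∑ j ∈ S, g k j ≤ ∑ j ∈ S, u (x i - y j) := by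
    intro i
    rw [← Finset.mul_prod_erase Finset.univ _ (Finset.mem_univ i)]
    refine (mul_le_of_le_one_right (hf0 i)
      (Finset.prod_le_one (fun k _ => hf0 k) (fun k _ => hf1 k))).trans ?_
    exact Finset.sum_le_sum fun j _ => hgu i j
  calc (N : ℝ) * ∑ J ∈ Fintype.piFinset (fun _ : Fin N => S), ∏ i, g i (J i)
      = ∑ _i : Fin N, ∏ k, ∑ j ∈ S, g k j := by rw [hprod]; simp
    _ ≤ _ := Finset.sum_le_sum fun i _ => hle i
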